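/- arXiv:2510.07237 — 2 statements merged into one kernel-verified Lean document; each statement's English description precedes it below -/
import Mathlib

section
/- Let c = (c_1, ..., c_k) be weakly decreasing with c_k = 1. Then every v ∈ Z^{k-1} has a unique c-satisfying representation over the c-recurrence vector sequence (X_{-n})_{n≥1}. -/
/-- `IsSR k c a` : the (1-indexed) sequence `a` is a c-satisfying representation string,
i.e. it decomposes, reading left to right, into blocks
`c_1, …, c_{s-1}, (digit < c_s), 0, …, 0`, possibly ending with a truncated block
equal to a proper initial segment of `c`. -/
inductive IsSR (k : ℕ) (c : ℕ → ℤ) : (ℕ → ℕ) → Prop where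
  | zero (a : ℕ → ℕ) (h : ∀ n, 1 ≤ n → a n = 0) : IsSR k c a
  | cprefix (a : ℕ → ℕ) (m : ℕ) (h1 : 1 ≤ m) (h2 : m < k)
      (h3 : ∀ n, 1 ≤ n → n ≤ m → (a n : ℤ) = c n)
      (h4 : ∀ n, m < n → a n = 0) : IsSR k c a
  | chunk (a : ℕ → ℕ) (s ℓ : ℕ) (hs1 : 1 ≤ s) (hs2 : s ≤ k)
      (h1 : ∀ n, 1 ≤ n → n < s → (a n : ℤ) = c n)
      (h2 : (a s : ℤ) < c s)
      (h3 : ∀ i, 1 ≤ i → i ≤ ℓ → a (s + i) = 0)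
      (h4 : IsSR k c (fun n => a (s + ℓ + n))) : IsSR k c a

/-- weak lexicographic condition -/
def QW (k : ℕ) (c : ℕ → ℤ) (a : ℕ → ℕ) : Prop :=
  ∀ t, ∃ s, 1 ≤ s ∧ s ≤ k ∧ (∀ i, 1 ≤ i → i < s → (a (t + i) : ℤ) ≤ c i) ∧ (a (t + s) : ℤ) < c s

/-- strong lexicographic condition -/
def QS (k : ℕ) (c : ℕ → ℤ) (a : ℕ → ℕ) : Prop :=
  ∀ t, ∃ s, 1 ≤ s ∧ s ≤ k ∧ (∀ i, 1 ≤ i → i < s → (a (t + i) : ℤ) = c i) ∧ (a (t + s) : ℤ) < c s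

/-- antitone on [1,k] -/
theorem c_anti {k : ℕ} {c : ℕ → ℤ} (hdec : ∀ i, 1 ≤ i → i < k → c (i + 1) ≤ c i)
    (i j : ℕ) (hi : 1 ≤ i) (hij : i ≤ j) (hj : j ≤ k) : c j ≤ c i := by
  induction j, hij using Nat.le_induction with
  | base => exact le_rfl
  | succ j hij ih => exact (hdec j (by omega) (by omega)).trans (ih (by omega))

theorem QW_of_IsSR {k : ℕ} {c : ℕ → ℤ} (hk : 2 ≤ k)
    (hanti : ∀ i j, 1 ≤ i → i ≤ j → j ≤ k → c j ≤ c i)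
    (hpos : ∀ i, 1 ≤ i → i ≤ k → 1 ≤ c i) {a : ℕ → ℕ} (h : IsSR k c a) : QW k c a := by
  induction h with
  | zero a h =>
    intro t
    refine ⟨1, le_rfl, by omega, fun i h1 h2 => by omega, ?_⟩
    rw [h _ (by omega)]
    have := hpos 1 le_rfl (by omega)
    push_cast; omega
  | cprefix a m h1 h2 h3 h4 =>
    intro t
    by_cases htm : t < m
    · refine ⟨m - t + 1, by omega, by omega, fun i hi1 hi2 => ?_, ?_⟩
      · rw [h3 _ (by omega) (by omega)]
        exact hanti _ _ hi1 (by omega) (by omega)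
      · rw [h4 _ (by omega)]
        have := hpos (m - t + 1) (by omega) (by omega)
        push_cast; omega
    · refine ⟨1, le_rfl, by omega, fun i h1 h2 => by omega, ?_⟩
      rw [h4 _ (by omega)]
      have := hpos 1 le_rfl (by omega)
      push_cast; omega
  | chunk a s l hs1 hs2 h1 h2 h3 h4 ih =>
    intro t
    by_cases hts : t < s
    · refine ⟨s - t, by omega, by omega, fun i hi1 hi2 => ?_, ?_⟩
      · rw [h1 _ (by omega) (by omega)]
        exact hanti _ _ hi1 (by omega) (by omega)
      · rw [show t + (s - t) = s by omega]
        exact h2.trans_le (hanti _ _ (by omega) (by omega) (by omega))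
    · by_cases htl : t < s + l
      · refine ⟨1, le_rfl, by omega, fun i h1 h2 => by omega, ?_⟩
        rw [show t + 1 = s + (t + 1 - s) by omega, h3 _ (by omega) (by omega)]
        have := hpos 1 le_rfl (by omega)
        push_cast; omega
      · obtain ⟨u, hu1, hu2, hu3, hu4⟩ := ih (t - (s + l))
        refine ⟨u, hu1, hu2, fun i hi1 hi2 => ?_, ?_⟩
        · have := hu3 i hi1 hi2
          simpa [show s + l + (t - (s + l) + i) = t + i by omega] using this
        · simpa [show s + l + (t - (s + l) + u) = t + u by omega] using hu4

theorem IsSR_of_QS {k : ℕ} {c : ℕ → ℤ} (M : ℕ) : ∀ (a : ℕ → ℕ), (∀ n, M < n → a n = 0) →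
    QS k c a → IsSR k c a := by
  induction M using Nat.strong_induction_on with
  | _ M ih =>
    intro a ha hQ
    by_cases hM : M = 0
    · exact IsSR.zero a fun n hn => ha n (by omega)
    · obtain ⟨s, h1, h2, h3, h4⟩ := hQ 0
      refine IsSR.chunk a s 0 h1 h2 (by simpa using h3) (by simpa using h4) (fun i _ _ => by omega) ?_
      refine ih (M - s) (by omega) _ (fun n hn => ha _ (by omega)) ?_
      intro t
      obtain ⟨u, hu1, hu2, hu3, hu4⟩ := hQ (s + t)
      refine ⟨u, hu1, hu2, fun i hi1 hi2 => ?_, ?_⟩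
      · have := hu3 i hi1 hi2
        simpa [add_assoc] using this
      · simpa [add_assoc] using hu4

/-- partial values -/
noncomputable def WW (x : ℝ) (a : ℕ → ℕ) (t N : ℕ) : ℝ :=
  ∑ i ∈ Finset.range N, (a (t + i + 1) : ℝ) * x ^ (i + 1)

theorem WW_nonneg {x : ℝ} (hx : 0 < x) (a : ℕ → ℕ) (t N : ℕ) : 0 ≤ WW x a t N :=
  Finset.sum_nonneg fun i _ => by positivity

theorem WW_add (x : ℝ) (a : ℕ → ℕ) (t s N : ℕ) :
    WW x a t (s + N) = WW x a t s + x ^ s * WW x a (t + s) N := by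
  unfold WW
  rw [Finset.sum_range_add, Finset.mul_sum]
  congr 1
  refine Finset.sum_congr rfl fun i _ => ?_
  rw [show t + (s + i) + 1 = t + s + i + 1 by omega]
  ring

theorem WW_lt_one {k : ℕ} {c : ℕ → ℤ} {x : ℝ} (hx : 0 < x)
    (hpos : ∀ i, 1 ≤ i → i ≤ k → 1 ≤ c i)
    (hroot : ∑ i ∈ Finset.range k, (c (i + 1) : ℝ) * x ^ (i + 1) = 1)
    {a : ℕ → ℕ} (hQ : QW k c a) (N : ℕ) : ∀ t, WW x a t N < 1 := by
  have hpc : ∀ i, i < k → (0 : ℝ) < (c (i + 1) : ℝ) * x ^ (i + 1) := fun i hi => by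
    have := hpos (i + 1) (by omega) (by omega)
    have : (0 : ℝ) < c (i + 1) := by exact_mod_cast this
    positivity
  have hmono : ∀ s, s ≤ k → ∑ i ∈ Finset.range s, (c (i + 1) : ℝ) * x ^ (i + 1) ≤ 1 := by
    intro s hs
    rw [← hroot]
    refine Finset.sum_le_sum_of_subset_of_nonneg (by simpa using hs) ?_
    intro i hi _
    exact (hpc i (by simpa using hi)).le
  induction N using Nat.strong_induction_on with
  | _ N ih =>
    intro t
    obtain ⟨s, h1, h2, h3, h4⟩ := hQ t
    have hle : ∀ n, n < s → WW x a t n ≤ ∑ i ∈ Finset.range n, (c (i + 1) : ℝ) * x ^ (i + 1) := by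
      intro n hn
      refine Finset.sum_le_sum fun i hi => ?_
      have hi' : i < n := by simpa using hi
      have := h3 (i + 1) (by omega) (by omega)
      have : (a (t + i + 1) : ℝ) ≤ c (i + 1) := by exact_mod_cast this
      gcongr
    by_cases hN : N < s
    · have e1 := hle N hN
      have e2 := hmono (N + 1) (by omega)
      rw [Finset.sum_range_succ] at e2
      have := hpc N (by omega)
      linarith
    · obtain ⟨r, rfl⟩ : ∃ r, s = r + 1 := ⟨s - 1, by omega⟩
      obtain ⟨m, rfl⟩ : ∃ m, N = (r + 1) + m := ⟨N - (r + 1), by omega⟩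
      rw [WW_add]
      have e1 := hle r (by omega)
      have e2 := hmono (r + 1) h2
      rw [Finset.sum_range_succ] at e2
      have e3 : WW x a t (r + 1) = WW x a t r + (a (t + r + 1) : ℝ) * x ^ (r + 1) := by
        unfold WW; rw [Finset.sum_range_succ]
      have e4 := ih m (by omega) (t + (r + 1))
      have e5 : (a (t + r + 1) : ℝ) + 1 ≤ c (r + 1) := by
        have : (a (t + r + 1) : ℤ) + 1 ≤ c (r + 1) := h4
        exact_mod_cast this
      have hxp : 0 < x ^ (r + 1) := by positivity
      have e6 := mul_le_mul_of_nonneg_right e5 hxp.le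
      have e7 := mul_lt_mul_of_pos_left e4 hxp
      linarith

theorem WW_inj {x : ℝ} (hx : 0 < x) {a b : ℕ → ℕ} (ha : ∀ N t, WW x a t N < 1)
    (hb : ∀ N t, WW x b t N < 1) (N : ℕ) : ∀ t, WW x a t N = WW x b t N →
    ∀ i, i < N → a (t + i + 1) = b (t + i + 1) := by
  induction N with
  | zero => intro t _ i hi; omega
  | succ N ih =>
    intro t h i hi
    rw [add_comm N 1, WW_add, WW_add] at h
    have e1 : ∀ d : ℕ → ℕ, WW x d t 1 = d (t + 1) * x := by intro d; simp [WW]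
    rw [e1, e1, pow_one] at h
    have h' : (a (t + 1) : ℝ) + WW x a (t + 1) N = b (t + 1) + WW x b (t + 1) N := by
      apply mul_left_cancel₀ hx.ne'
      linarith
    have f1 := ha N (t + 1)
    have f2 := hb N (t + 1)
    have f3 := WW_nonneg hx a (t + 1) N
    have f4 := WW_nonneg hx b (t + 1) N
    have heq : a (t + 1) = b (t + 1) := by
      have g1 : (a (t + 1) : ℝ) < b (t + 1) + 1 := by linarith
      have g2 : (b (t + 1) : ℝ) < a (t + 1) + 1 := by linarith
      have g1' : a (t + 1) < b (t + 1) + 1 := by exact_mod_cast g1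
      have g2' : b (t + 1) < a (t + 1) + 1 := by exact_mod_cast g2
      omega
    cases i with
    | zero => exact heq
    | succ i =>
      rw [heq] at h'
      have := ih (t + 1) (by linarith) i (by omega)
      rw [show t + (i + 1) + 1 = t + 1 + i + 1 by omega]
      exact this

theorem exists_root {k : ℕ} (hk : 2 ≤ k) {c : ℕ → ℤ} (hpos : ∀ i, 1 ≤ i → i ≤ k → 1 ≤ c i) :
    ∃ x : ℝ, 0 < x ∧ x < 1 ∧ ∑ i ∈ Finset.range k, (c (i + 1) : ℝ) * x ^ (i + 1) = 1 := by
  have hcont : Continuous fun x : ℝ => ∑ i ∈ Finset.range k, (c (i + 1) : ℝ) * x ^ (i + 1) := by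
    fun_prop
  have h1 : (1 : ℝ) < ∑ i ∈ Finset.range k, (c (i + 1) : ℝ) * (1 : ℝ) ^ (i + 1) := by
    have : ∑ i ∈ Finset.range k, (1 : ℝ) ≤
        ∑ i ∈ Finset.range k, (c (i + 1) : ℝ) * (1 : ℝ) ^ (i + 1) := by
      refine Finset.sum_le_sum fun i hi => ?_
      have hi' : i < k := by simpa using hi
      have := hpos (i + 1) (by omega) (by omega)
      have : (1 : ℝ) ≤ c (i + 1) := by exact_mod_cast this
      simpa using this
    have hk' : (2 : ℝ) ≤ k := by exact_mod_cast hk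
    simp only [Finset.sum_const, Finset.card_range, nsmul_eq_mul, mul_one] at this
    linarith
  have h0 : ∑ i ∈ Finset.range k, (c (i + 1) : ℝ) * (0 : ℝ) ^ (i + 1) < 1 := by simp
  obtain ⟨x, hx, hx'⟩ := intermediate_value_Ioo (zero_le_one) hcont.continuousOn ⟨h0, h1⟩
  exact ⟨x, hx.1, hx.2, hx'⟩

/-- sum of a finitely supported digit string against a sequence -/
noncomputable abbrev LL {M : Type*} [AddCommMonoid M] (f : ℕ → M) : (ℕ →₀ ℕ) →ₗ[ℕ] M :=
  Finsupp.linearCombination ℕ f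

/-- shifted copy of c -/
noncomputable def sh (k : ℕ) (c : ℕ → ℤ) (t : ℕ) : ℕ →₀ ℕ :=
  ∑ l ∈ Finset.Icc 1 k, Finsupp.single (t + l) (c l).toNat

theorem sh_apply (k : ℕ) (c : ℕ → ℤ) (t p : ℕ) :
    sh k c t p = if t + 1 ≤ p ∧ p ≤ t + k then (c (p - t)).toNat else 0 := by
  unfold sh
  rw [Finsupp.finsetSum_apply]
  split_ifs with h
  · rw [Finset.sum_eq_single (p - t)]
    · rw [show t + (p - t) = p by omega]; simp
    · intro b hb hne
      rw [Finsupp.single_eq_of_ne]; omega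
    · intro hn; exfalso; apply hn; simp; omega
  · refine Finset.sum_eq_zero fun l hl => ?_
    rw [Finset.mem_Icc] at hl
    rw [Finsupp.single_eq_of_ne]; omega

theorem LL_sh {M : Type*} [AddCommMonoid M] (f : ℕ → M) (k : ℕ) (c : ℕ → ℤ) (t : ℕ) :
    LL f (sh k c t) = ∑ l ∈ Finset.Icc 1 k, (c l).toNat • f (t + l) := by
  simp [sh, LL, map_sum, Finsupp.linearCombination_single]

theorem fin_set {x : ℝ} (hx : 0 < x) (hx1 : x < 1) (D : ℕ) : ∀ r : ℝ,
    {a : ℕ →₀ ℕ | LL (fun _ => (1 : ℕ)) a = D ∧ LL (fun n => x ^ n) a = r}.Finite := by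
  have hmass : ∀ a : ℕ →₀ ℕ, ∀ n, a n ≠ 0 → ∃ b : ℕ →₀ ℕ, a = b + Finsupp.single n 1 := by
    intro a n hn
    refine ⟨a - Finsupp.single n 1, ?_⟩
    rw [tsub_add_cancel_of_le]
    rw [Finsupp.single_le_iff]; omega
  induction D with
  | zero =>
    intro r
    refine (Set.finite_singleton (0 : ℕ →₀ ℕ)).subset ?_
    rintro a ⟨h1, -⟩
    rw [Set.mem_singleton_iff]
    by_contra hne
    obtain ⟨n, hn⟩ := Finsupp.ne_iff.mp hne
    obtain ⟨b, rfl⟩ := hmass a n hn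
    simp [map_add, Finsupp.linearCombination_single] at h1
  | succ D ih =>
    intro r
    by_cases hr : 0 < r
    · obtain ⟨N, hN⟩ := exists_pow_lt_of_lt_one (show 0 < r / (D + 1) by positivity) hx1
      refine ((Set.finite_Iio N).biUnion fun n _ =>
        (ih (r - x ^ n)).image (fun b => b + Finsupp.single n 1)).subset ?_
      rintro a ⟨h1, h2⟩
      have hex : ∃ n, n < N ∧ a n ≠ 0 := by
        by_contra hcon
        push Not at hcon
        have hle : LL (fun n => x ^ n) a ≤ x ^ N * (LL (fun _ => (1 : ℕ)) a : ℕ) := by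
          simp only [LL, Finsupp.linearCombination_apply, Finsupp.sum]
          push_cast
          rw [Finset.mul_sum]
          refine Finset.sum_le_sum fun n hn => ?_
          have hnN : N ≤ n := by
            by_contra hlt
            exact (Finsupp.mem_support_iff.mp hn) (hcon n (by omega))
          have := pow_le_pow_of_le_one hx.le hx1.le hnN
          simp only [nsmul_eq_mul, smul_eq_mul, mul_one]
          rw [mul_comm]
          gcongr
        rw [h1, h2] at hle
        rw [lt_div_iff₀ (by positivity)] at hN
        push_cast at hle
        linarith
      obtain ⟨n, hn, han⟩ := hex
      obtain ⟨b, rfl⟩ := hmass a n han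
      simp only [Set.mem_iUnion]
      refine ⟨n, hn, b, ⟨?_, ?_⟩, rfl⟩
      · simp only [map_add, Finsupp.linearCombination_single, smul_eq_mul, mul_one] at h1
        omega
      · simp only [map_add, Finsupp.linearCombination_single, one_smul] at h2
        linarith
    · convert Set.finite_empty
      rw [Set.eq_empty_iff_forall_notMem]
      rintro a ⟨h1, h2⟩
      have hne : a ≠ 0 := by rintro rfl; simp at h1
      obtain ⟨n, hn⟩ := Finsupp.ne_iff.mp hne
      obtain ⟨b, rfl⟩ := hmass a n hn
      simp only [map_add, Finsupp.linearCombination_single, one_smul] at h2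
      have : 0 ≤ LL (fun n => x ^ n) b := by
        simp only [LL, Finsupp.linearCombination_apply, Finsupp.sum]
        exact Finset.sum_nonneg fun i _ => by positivity
      have hp : 0 < x ^ n := by positivity
      apply hr
      linarith

/-- violation of QS -/
theorem not_QS {k : ℕ} {c : ℕ → ℤ} {a : ℕ → ℕ} (h : ¬ QS k c a) :
    ∃ t, (∀ i, 1 ≤ i → i ≤ k → (a (t + i) : ℤ) = c i) ∨
      ∃ j, 1 ≤ j ∧ j ≤ k ∧ (∀ i, 1 ≤ i → i < j → (a (t + i) : ℤ) = c i) ∧ c j < a (t + j) := by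
  classical
  unfold QS at h
  push Not at h
  obtain ⟨t, ht⟩ := h
  refine ⟨t, ?_⟩
  by_cases hall : ∀ i, 1 ≤ i → i ≤ k → (a (t + i) : ℤ) = c i
  · exact Or.inl hall
  · right
    push Not at hall
    have hs := Nat.find_spec hall
    have hm : ∀ i, i < Nat.find hall → ¬ _ := fun i hi => Nat.find_min hall hi
    set j := Nat.find hall with hj
    have hlt : ∀ i, 1 ≤ i → i < j → (a (t + i) : ℤ) = c i := by
      intro i h1 h2
      by_contra hne
      exact hm i h2 ⟨h1, by omega, hne⟩
    refine ⟨j, hs.1, hs.2.1, hlt, ?_⟩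
    exact lt_of_le_of_ne (ht j hs.1 hs.2.1 hlt) (Ne.symm hs.2.2)

theorem main_exists {k : ℕ} (hk : 2 ≤ k) {c : ℕ → ℤ}
    (hanti : ∀ i j, 1 ≤ i → i ≤ j → j ≤ k → c j ≤ c i)
    (hpos : ∀ i, 1 ≤ i → i ≤ k → 1 ≤ c i) {G : Type*} [AddCommGroup G] (g : ℕ → G)
    (hg0 : g 0 = 0) (hg : ∀ n, g n = ∑ l ∈ Finset.Icc 1 k, c l • g (n + l)) (v : G)
    (hv : ∃ a, LL g a = v) :
    ∃ a : ℕ →₀ ℕ, LL g a = v ∧ a 0 = 0 ∧ QS k c a := by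
  classical
  obtain ⟨x, hx, hx1, hroot⟩ := exists_root hk hpos
  have hex : ∃ D, ∃ a, LL g a = v ∧ LL (fun _ => (1 : ℕ)) a = D := by
    obtain ⟨a, ha⟩ := hv
    exact ⟨_, a, ha, rfl⟩
  obtain ⟨a0, ha0, hD⟩ := Nat.find_spec hex
  have hmin : ∀ a, LL g a = v → Nat.find hex ≤ LL (fun _ => (1 : ℕ)) a :=
    fun a ha => Nat.find_min' hex ⟨a, ha, rfl⟩
  set D := Nat.find hex
  set r := LL (fun n => x ^ n) a0 with hr
  let S : Set (ℕ →₀ ℕ) := {a | (LL (fun _ => (1 : ℕ)) a = D ∧ LL (fun n => x ^ n) a = r) ∧ LL g a = v}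
  have hSfin : S.Finite := (fin_set hx hx1 D r).subset fun a ha => ha.1
  obtain ⟨a, haS, hamax⟩ := Set.exists_max_image S (LL (fun n : ℕ => n)) hSfin ⟨a0, ⟨hD, rfl⟩, ha0⟩
  obtain ⟨⟨hm, hxr⟩, hgv⟩ := haS
  -- recurrences in toNat form
  have hgn : ∀ n, LL g (sh k c n) = g n := by
    intro n
    rw [LL_sh, hg n]
    refine Finset.sum_congr rfl fun l hl => ?_
    rw [Finset.mem_Icc] at hl
    have := hpos l hl.1 hl.2
    rw [← natCast_zsmul, Int.toNat_of_nonneg (by omega)]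
  have hxn : ∀ n, LL (fun n => x ^ n) (sh k c n) = x ^ n := by
    intro n
    rw [LL_sh, ← mul_one (x ^ n), ← hroot, Finset.mul_sum, Finset.range_eq_Ico,
      Finset.sum_Ico_add' (fun l => x ^ n * ((c l : ℝ) * x ^ l)) 0 k 1]
    refine Finset.sum_congr rfl fun l hl => ?_
    have hl' : 1 ≤ l ∧ l ≤ k := by simpa using hl
    have := hpos l hl'.1 hl'.2
    have e : ((c l).toNat : ℝ) = (c l : ℝ) := by
      have : ((c l).toNat : ℤ) = c l := Int.toNat_of_nonneg (by omega)
      exact_mod_cast this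
    rw [nsmul_eq_mul, e, pow_add]; ring
  have hC : ∀ n, LL (fun _ => (1 : ℕ)) (sh k c n) = ∑ l ∈ Finset.Icc 1 k, (c l).toNat := by
    intro n; rw [LL_sh]; simp
  have hC2 : 2 ≤ ∑ l ∈ Finset.Icc 1 k, (c l).toNat := by
    have : ∑ l ∈ Finset.Icc 1 k, 1 ≤ ∑ l ∈ Finset.Icc 1 k, (c l).toNat := by
      refine Finset.sum_le_sum fun l hl => ?_
      rw [Finset.mem_Icc] at hl
      have := hpos l hl.1 hl.2
      omega
    simp at this; omega
  have hI : ∀ n, LL (fun n : ℕ => n) (sh k c n) =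
      (∑ l ∈ Finset.Icc 1 k, (c l).toNat) * n + ∑ l ∈ Finset.Icc 1 k, (c l).toNat * l := by
    intro n; rw [LL_sh, Finset.sum_mul, ← Finset.sum_add_distrib]
    refine Finset.sum_congr rfl fun l hl => ?_
    simp; ring
  set C := ∑ l ∈ Finset.Icc 1 k, (c l).toNat with hCdef
  set E := ∑ l ∈ Finset.Icc 1 k, (c l).toNat * l with hEdef
  -- minimal mass forces zero at position 0
  have hzero : ∀ b, LL g b = v → LL (fun _ => (1 : ℕ)) b = D → b 0 = 0 := by
    intro b hb hbD
    by_contra hne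
    have hle : Finsupp.single 0 1 ≤ b := by rw [Finsupp.single_le_iff]; omega
    obtain ⟨b', rfl⟩ := exists_add_of_le hle
    simp only [map_add, Finsupp.linearCombination_single, one_smul, hg0, zero_add] at hb hbD
    have := hmin b' hb
    omega
  refine ⟨a, hgv, hzero a hgv hm, ?_⟩
  by_contra hnQ
  obtain ⟨t, ht | ⟨j, hj1, hj2, hj3, hj4⟩⟩ := not_QS hnQ
  · have hle : sh k c t ≤ a := by
      intro p
      rw [sh_apply]
      split_ifs with h
      · have := ht (p - t) (by omega) (by omega)
        rw [show t + (p - t) = p by omega] at this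
        omega
      · omega
    obtain ⟨b, rfl⟩ := exists_add_of_le hle
    have h1 : LL g (b + Finsupp.single t 1) = v := by
      rw [← hgv, map_add, map_add, hgn, Finsupp.linearCombination_single, one_smul, add_comm]
    have h2 := hmin _ h1
    rw [map_add, hC] at hm
    rw [map_add, Finsupp.linearCombination_single] at h2
    simp only [smul_eq_mul, mul_one] at h2
    omega
  · have hle : sh k c t + Finsupp.single (t + j) 1 ≤ a + sh k c (t + j) := by
      intro p
      rw [Finsupp.add_apply, Finsupp.add_apply, sh_apply, sh_apply]
      by_cases h1 : p ≤ t
      · rw [if_neg (by omega), Finsupp.single_eq_of_ne (by omega)]; omega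
      · obtain ⟨i, rfl⟩ : ∃ i, p = t + i := ⟨p - t, by omega⟩
        rw [show t + i - t = i by omega]
        rcases lt_trichotomy i j with h | h | h
        · have := hj3 i (by omega) h
          rw [Finsupp.single_eq_of_ne (by omega), if_pos (by omega)]
          omega
        · subst h
          have := hpos i hj1 hj2
          rw [Finsupp.single_eq_same, if_pos (by omega)]
          omega
        · rw [Finsupp.single_eq_of_ne (by omega)]
          by_cases hik : i ≤ k
          · rw [if_pos (by omega), if_pos (by omega), show t + i - (t + j) = i - j by omega]
            have := hanti (i - j) i (by omega) (by omega) hik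
            omega
          · rw [if_neg (by omega)]; omega
    obtain ⟨b, hb⟩ := exists_add_of_le hle
    have key : ∀ {M : Type} [AddCommMonoid M] (f : ℕ → M),
        LL f a + LL f (sh k c (t + j)) = LL f (sh k c t) + f (t + j) + LL f b := by
      intro M _ f
      have := congrArg (LL f) hb
      simpa only [map_add, Finsupp.linearCombination_single, one_smul] using this
    have keyg : LL g a + LL g (sh k c (t + j)) = LL g (sh k c t) + g (t + j) + LL g b := by
      have := congrArg (LL g) hb
      simpa only [map_add, Finsupp.linearCombination_single, one_smul] using this
    have k1 := key (fun _ => (1 : ℕ))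
    have k2 := key (fun n => x ^ n)
    have k3 := key (fun n : ℕ => n)
    rw [hgn, hgn] at keyg
    rw [hC, hC] at k1
    rw [hxn, hxn] at k2
    rw [hI, hI] at k3
    have g1 : LL g (b + Finsupp.single t 1) = v := by
      rw [map_add, Finsupp.linearCombination_single, one_smul, ← hgv]
      have : LL g a + g (t + j) = (LL g b + g t) + g (t + j) := by rw [keyg]; abel
      exact (add_right_cancel this).symm
    have g2 : LL (fun _ => (1 : ℕ)) (b + Finsupp.single t 1) = D := by
      rw [map_add, Finsupp.linearCombination_single]
      simp only [smul_eq_mul, mul_one]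
      omega
    have g3 : LL (fun n => x ^ n) (b + Finsupp.single t 1) = r := by
      rw [map_add, Finsupp.linearCombination_single, one_smul, ← hxr]
      linarith
    have g4 := hamax _ ⟨⟨g2, g3⟩, g1⟩
    rw [map_add, Finsupp.linearCombination_single, one_smul] at g4
    have : j < C * j := by nlinarith
    have e : C * (t + j) = C * t + C * j := by ring
    rw [e] at k3
    omega

/-- For weakly decreasing c with c_k = 1, every vector of ℤ^{k-1} has a unique
c-satisfying representation over the c-recurrence vector sequence. -/
theorem exists_unique_cSR
    (k : ℕ) (hk : 2 ≤ k) (c : ℕ → ℤ)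
    (hc1 : 0 < c 1)
    (hdec : ∀ i, 1 ≤ i → i < k → c (i + 1) ≤ c i) (hck : c k = 1)
    (V : ℤ → Fin (k - 1) → ℤ)
    (hV0 : V 0 = 0)
    (hVe : ∀ i : ℕ, 1 ≤ i → i ≤ k - 1 →
      V (-(i : ℤ)) = fun j : Fin (k - 1) => if (j : ℕ) + 1 = i then 1 else 0)
    (hVrec : ∀ n : ℤ, V n = ∑ l ∈ Finset.Icc 1 k, c l • V (n - (l : ℤ))) :
    ∀ v : Fin (k - 1) → ℤ,
      (∃ a : ℕ → ℕ, IsSR k c a ∧ ∃ M : ℕ, (∀ n, M < n → a n = 0) ∧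
          v = ∑ n ∈ Finset.Icc 1 M, (a n : ℤ) • V (-(n : ℤ))) ∧
      (∀ a b : ℕ → ℕ,
        (IsSR k c a ∧ ∃ M : ℕ, (∀ n, M < n → a n = 0) ∧
          v = ∑ n ∈ Finset.Icc 1 M, (a n : ℤ) • V (-(n : ℤ))) →
        (IsSR k c b ∧ ∃ M : ℕ, (∀ n, M < n → b n = 0) ∧
          v = ∑ n ∈ Finset.Icc 1 M, (b n : ℤ) • V (-(n : ℤ))) →
        ∀ n, 1 ≤ n → a n = b n) := by
  have hanti := c_anti hdec
  have hpos : ∀ i, 1 ≤ i → i ≤ k → 1 ≤ c i := fun i h1 h2 => hck ▸ hanti i k h1 h2 le_rfl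
  set g : ℕ → (Fin (k - 1) → ℤ) := fun n => V (-(n : ℤ)) with hgdef
  have hg0 : g 0 = 0 := by simpa [hgdef] using hV0
  have hg : ∀ n, g n = ∑ l ∈ Finset.Icc 1 k, c l • g (n + l) := by
    intro n
    simp only [hgdef]
    rw [hVrec]
    refine Finset.sum_congr rfl fun l _ => ?_
    congr 2
    push_cast; ring
  have hge : ∀ i : Fin (k - 1), g (i + 1) = Pi.single i 1 := by
    intro i
    have := hVe (i + 1) (by omega) (by omega)
    simp only [hgdef]
    rw [this]
    funext j
    by_cases h : j = i
    · subst h; simp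
    · have h' : (j : ℕ) ≠ i := fun h' => h (Fin.ext h')
      simp [h, h']
  intro v
  constructor
  · have hrep : ∃ a, LL g a = v := by
      have hmem : ∀ n, g n ∈ LinearMap.range (LL g) := fun n =>
        ⟨Finsupp.single n 1, by rw [Finsupp.linearCombination_single, one_smul]⟩
      have hneg : ∀ i : Fin (k - 1), -g (i + 1) ∈ LinearMap.range (LL g) := by
        intro i
        have h0 := hg 0
        have hi : (i : ℕ) + 1 ∈ Finset.Icc 1 k := by rw [Finset.mem_Icc]; omega
        rw [hg0, ← Finset.add_sum_erase _ _ hi, zero_add] at h0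
        have hci := hpos (i + 1) (by omega) (by omega)
        have : -g (i + 1) = (c (i + 1) - 1).toNat • g (i + 1) +
            ∑ l ∈ (Finset.Icc 1 k).erase (i + 1), (c l).toNat • g l := by
          have e1 : (c (i + 1) - 1).toNat • g (i + 1) = c (i + 1) • g (i + 1) - g (i + 1) := by
            rw [← natCast_zsmul, Int.toNat_of_nonneg (by omega), sub_smul, one_smul]
          have e2 : ∑ l ∈ (Finset.Icc 1 k).erase (i + 1), (c l).toNat • g l =
              ∑ l ∈ (Finset.Icc 1 k).erase ((i : ℕ) + 1), c l • g (0 + l) := by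
            refine Finset.sum_congr rfl fun l hl => ?_
            rw [Finset.mem_erase, Finset.mem_Icc] at hl
            have := hpos l hl.2.1 hl.2.2
            rw [← natCast_zsmul, Int.toNat_of_nonneg (by omega), zero_add]
          rw [e1, e2, sub_add_eq_add_sub, ← h0, zero_sub]
        rw [this]
        exact add_mem (Submodule.smul_mem _ _ (hmem _))
          (sum_mem fun l _ => Submodule.smul_mem _ _ (hmem _))
      have hv : v = ∑ i, v i • g (i + 1) := by
        simp only [hge]
        exact pi_eq_sum_univ' v
      have : v ∈ LinearMap.range (LL g) := by
        rw [hv]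
        refine sum_mem fun i _ => ?_
        rcases Int.eq_nat_or_neg (v i) with ⟨n, h | h⟩
        · rw [h, natCast_zsmul]; exact Submodule.smul_mem _ _ (hmem _)
        · rw [h, neg_smul, ← smul_neg, natCast_zsmul]; exact Submodule.smul_mem _ _ (hneg _)
      exact this
    obtain ⟨a, ha, ha0, hQ⟩ := main_exists hk hanti hpos g hg0 hg v hrep
    have hM : ∀ n, a.support.sup id < n → a n = 0 := by
      intro n hn
      by_contra hne
      have := Finset.le_sup (f := id) (Finsupp.mem_support_iff.mpr hne)
      simp only [id] at this hn
      omega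
    refine ⟨a, IsSR_of_QS _ a hM hQ, a.support.sup id, hM, ?_⟩
    rw [← ha, Finsupp.linearCombination_apply, Finsupp.sum_of_support_subset (s := Finset.Icc 1 (a.support.sup id))]
    · refine Finset.sum_congr rfl fun n _ => ?_
      rw [natCast_zsmul]
    · intro n hn
      rw [Finset.mem_Icc]
      refine ⟨?_, Finset.le_sup (f := id) hn⟩
      rw [Finsupp.mem_support_iff] at hn
      by_contra h
      have : n = 0 := by omega
      exact hn (this ▸ ha0)
    · simp
  · obtain ⟨x, hx, hx1, hroot⟩ := exists_root hk hpos
    let F : (Fin (k - 1) → ℤ) →+ ℝ :=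
      { toFun := fun w => ∑ i, (w i : ℝ) * x ^ ((i : ℕ) + 1)
        map_zero' := by simp
        map_add' := fun w w' => by
          simp only [Pi.add_apply, Int.cast_add, add_mul, Finset.sum_add_distrib] }
    have hroot' : ∀ n, x ^ n = ∑ l ∈ Finset.Icc 1 k, c l • x ^ (n + l) := by
      intro n
      conv_lhs => rw [← mul_one (x ^ n), ← hroot, Finset.mul_sum, Finset.range_eq_Ico,
        Finset.sum_Ico_add' (fun l => x ^ n * ((c l : ℝ) * x ^ l)) 0 k 1]
      refine Finset.sum_congr rfl fun l hl => ?_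
      rw [zsmul_eq_mul, pow_add]; ring
    have hd : ∀ n, F (g n) - x ^ n = ∑ l ∈ Finset.Icc 1 k, c l • (F (g (n + l)) - x ^ (n + l)) := by
      intro n
      simp only [smul_sub, Finset.sum_sub_distrib]
      rw [← hroot' n]
      conv_lhs => rw [hg n]
      simp only [map_sum, map_zsmul]
    have hZ : ∀ n, F (g n) - x ^ n ∈ (Int.castAddHom ℝ).range := by
      intro n
      induction n using Nat.strong_induction_on with
      | _ n ih =>
        by_cases hn0 : n = 0
        · subst hn0
          rw [hg0, map_zero]
          exact ⟨-1, by simp⟩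
        by_cases hnk : n ≤ k - 1
        · obtain ⟨i, rfl⟩ : ∃ i : Fin (k - 1), n = i + 1 := ⟨⟨n - 1, by omega⟩, by simp; omega⟩
          refine ⟨0, ?_⟩
          rw [hge]
          simp only [map_zero]
          symm
          rw [sub_eq_zero]
          change ∑ j, ((Pi.single i 1 : Fin (k - 1) → ℤ) j : ℝ) * x ^ ((j : ℕ) + 1) = _
          rw [Finset.sum_eq_single i]
          · simp
          · intro j _ hj; simp [hj]
          · simp
        · have h := hd (n - k)
          have hkm : k ∈ Finset.Icc 1 k := by rw [Finset.mem_Icc]; omega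
          rw [← Finset.add_sum_erase _ _ hkm, hck, one_smul, show n - k + k = n by omega] at h
          have h' := sub_eq_of_eq_add h
          rw [← h']
          refine sub_mem (ih _ (by omega)) (sum_mem fun l hl => zsmul_mem (ih _ ?_) _)
          rw [Finset.mem_erase, Finset.mem_Icc] at hl
          omega
    have hFv : ∀ (a : ℕ → ℕ) (M N : ℕ), (∀ n, M < n → a n = 0) → M ≤ N →
        v = ∑ n ∈ Finset.Icc 1 M, (a n : ℤ) • V (-(n : ℤ)) →
        F v - WW x a 0 N ∈ (Int.castAddHom ℝ).range := by
      intro a M N hM hMN hv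
      have hv' : v = ∑ n ∈ Finset.Icc 1 N, (a n : ℤ) • g n := by
        rw [hv]
        refine Finset.sum_subset (Finset.Icc_subset_Icc_right hMN) ?_
        intro n hn hn'
        rw [Finset.mem_Icc] at hn hn'
        rw [hM n (by omega)]; simp
      have hW : WW x a 0 N = ∑ n ∈ Finset.Icc 1 N, (a n : ℤ) • x ^ n := by
        unfold WW
        rw [Finset.range_eq_Ico]
        simp only [zero_add]
        rw [Finset.sum_Ico_add' (fun l => ((a l : ℝ) * x ^ l)) 0 N 1]
        refine Finset.sum_congr rfl fun l hl => ?_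
        simp
      rw [hW, hv', map_sum, ← Finset.sum_sub_distrib]
      refine sum_mem fun n _ => ?_
      rw [map_zsmul, ← smul_sub]
      exact zsmul_mem (hZ n) _
    rintro a b ⟨haS, M, hM, hav⟩ ⟨hbS, M', hM', hbv⟩ n hn
    have ha1 := WW_lt_one hx hpos hroot (QW_of_IsSR hk hanti hpos haS)
    have hb1 := WW_lt_one hx hpos hroot (QW_of_IsSR hk hanti hpos hbS)
    set N := max (max M M') n with hN
    have h1 := hFv a M N hM (by omega) hav
    have h2 := hFv b M' N hM' (by omega) hbv
    obtain ⟨z, hz⟩ := sub_mem h1 h2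
    have f1 := ha1 N 0
    have f2 := hb1 N 0
    have f3 := WW_nonneg hx a 0 N
    have f4 := WW_nonneg hx b 0 N
    have hz' : (z : ℝ) = WW x b 0 N - WW x a 0 N := by
      have : (z : ℝ) = F v - WW x a 0 N - (F v - WW x b 0 N) := hz
      linarith
    have hz0 : z = 0 := by
      have g1 : (z : ℝ) < 1 := by linarith
      have g2 : (-1 : ℝ) < z := by linarith
      have g1' : z < 1 := by exact_mod_cast g1
      have g2' : -1 < z := by exact_mod_cast g2
      omega
    have heq : WW x a 0 N = WW x b 0 N := by
      rw [hz0] at hz'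
      push_cast at hz'
      linarith
    have := WW_inj hx ha1 hb1 N 0 heq (n - 1) (by omega)
    rwa [show 0 + (n - 1) + 1 = n by omega] at this
end

section
/- Let (X_n) be the scalar PLRS for a weakly decreasing recurrence vector c = (c_1,...,c_k) with c_k = 1. Then the legal (Zeckendorf-type) decomposition of any positive integer N over (X_n) uses the minimal number of summands among all representations of N as nonnegative integer combinations Σ a_n X_n. -/
/-- Number of coins used by the greedy algorithm with coins `X 1, …, X n`. -/
def greedyCost (X : ℕ → ℤ) : ℕ → ℤ → ℤ
  | 0, _ => 0
  | n + 1, N => N / X (n + 1) + greedyCost X n (N % X (n + 1))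

theorem greedyCost_add_mul (X : ℕ → ℤ) (hX : ∀ n, 1 ≤ n → 0 < X n) (n : ℕ) (hn : 1 ≤ n)
    (N u : ℤ) : greedyCost X n (N + u * X n) = greedyCost X n N + u := by
  obtain ⟨n, rfl⟩ : ∃ p, n = p + 1 := ⟨n - 1, by omega⟩
  have h := hX (n + 1) (by omega)
  simp only [greedyCost, Int.add_mul_emod_self_right]
  rw [Int.add_mul_ediv_right _ _ h.ne']
  ring

theorem greedyCost_of_lt (X : ℕ → ℤ) (n : ℕ) (N : ℤ) (h0 : 0 ≤ N) (h : N < X (n + 1)) :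
    greedyCost X (n + 1) N = greedyCost X n N := by
  simp only [greedyCost]
  rw [Int.ediv_eq_zero_of_lt h0 h, Int.emod_eq_of_lt h0 h]
  ring

/-- Adding one coin raises the greedy cost by at most one. -/
def Orderly (X : ℕ → ℤ) (n : ℕ) : Prop :=
  ∀ V : ℤ, 0 ≤ V → ∀ j, 1 ≤ j → j ≤ n → greedyCost X n (V + X j) ≤ greedyCost X n V + 1

theorem Orderly.mul {X : ℕ → ℤ} (hX : ∀ n, 1 ≤ n → 0 < X n) {n : ℕ} (h : Orderly X n)
    (V : ℤ) (hV : 0 ≤ V) (j : ℕ) (h1 : 1 ≤ j) (h2 : j ≤ n) (u : ℕ) :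
    greedyCost X n (V + u * X j) ≤ greedyCost X n V + u := by
  induction u with
  | zero => simp
  | succ u ih =>
    have hj := hX j h1
    have := h (V + u * X j) (by positivity) j h1 h2
    rw [show V + ((u + 1 : ℕ) : ℤ) * X j = V + u * X j + X j by push_cast; ring]
    push_cast
    linarith

theorem Orderly.step {X : ℕ → ℤ} (hX : ∀ n, 1 ≤ n → 0 < X n) {n : ℕ} (hn : 1 ≤ n)
    (h : Orderly X n) (d δ : ℤ) (hδ : (d + 1) * X n = X (n + 1) + δ)
    (hcost : ∀ V : ℤ, 0 ≤ V → greedyCost X n (V + δ) ≤ greedyCost X n V + d) :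
    Orderly X (n + 1) := by
  have hp := hX (n + 1) (by omega)
  have key : ∀ r : ℤ, 0 ≤ r → greedyCost X n r + 1 ≤ greedyCost X n (r + X (n + 1)) := by
    intro r hr
    have h1 := hcost (r + X (n + 1)) (by linarith)
    have h2 := greedyCost_add_mul X hX n hn r (d + 1)
    rw [hδ, ← add_assoc] at h2
    linarith
  have key2 : ∀ (u : ℕ) (r : ℤ), 0 ≤ r →
      greedyCost X n r + u ≤ greedyCost X n (r + u * X (n + 1)) := by
    intro u
    induction u with
    | zero => intro r _; simp
    | succ u ih =>
      intro r hr
      have h1 := ih r hr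
      have h2 := key (r + u * X (n + 1)) (by positivity)
      rw [show r + ((u + 1 : ℕ) : ℤ) * X (n + 1) = r + u * X (n + 1) + X (n + 1) by
        push_cast; ring]
      push_cast
      linarith
  have le : ∀ N : ℤ, 0 ≤ N → greedyCost X (n + 1) N ≤ greedyCost X n N := by
    intro N hN
    have h1 : 0 ≤ N / X (n + 1) := Int.ediv_nonneg hN hp.le
    obtain ⟨u, hu⟩ := Int.eq_ofNat_of_zero_le h1
    have h2 := key2 u (N % X (n + 1)) (Int.emod_nonneg _ hp.ne')
    have h3 := Int.emod_add_mul_ediv N (X (n + 1))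
    rw [hu, mul_comm] at h3
    rw [h3] at h2
    simp only [greedyCost]
    rw [hu]
    linarith
  intro V hV j h1 h2
  rcases Nat.lt_or_ge n j with hj | hj
  · obtain rfl : j = n + 1 := by omega
    have := greedyCost_add_mul X hX (n + 1) (by omega) V 1
    rw [one_mul] at this
    exact this.le
  · have h3 := Int.emod_add_mul_ediv V (X (n + 1))
    have hr := Int.emod_nonneg V hp.ne'
    have hr2 := Int.emod_lt_of_pos V hp
    generalize V % X (n + 1) = r at *
    generalize V / X (n + 1) = q at *
    subst h3
    rw [show r + X (n + 1) * q + X j = (r + X j) + q * X (n + 1) by ring,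
      show r + X (n + 1) * q = r + q * X (n + 1) by ring,
      greedyCost_add_mul X hX _ (by omega), greedyCost_add_mul X hX _ (by omega),
      greedyCost_of_lt X n r hr hr2]
    have := le (r + X j) (by have := hX j h1; linarith)
    have := h r hr j h1 hj
    linarith

theorem Orderly.one {X : ℕ → ℤ} (hX : ∀ n, 1 ≤ n → 0 < X n) : Orderly X 1 := by
  intro V hV j h1 h2
  obtain rfl : j = 1 := by omega
  have := greedyCost_add_mul X hX 1 le_rfl V 1
  rw [one_mul] at this
  exact this.le

theorem Orderly.diff {X : ℕ → ℤ} (hX : ∀ n, 1 ≤ n → 0 < X n) {n : ℕ} (h : Orderly X n)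
    (k : ℕ) (c : ℕ → ℤ) (hdec : ∀ i, 1 ≤ i → i < k → c (i + 1) ≤ c i)
    (p : ℕ) (hp1 : p < n) (hp2 : p < k) (V : ℤ) (hV : 0 ≤ V) :
    0 ≤ ∑ i ∈ Finset.Icc 1 p, (c i - c (i + 1)) * X (n - i) ∧
    greedyCost X n (V + ∑ i ∈ Finset.Icc 1 p, (c i - c (i + 1)) * X (n - i))
      ≤ greedyCost X n V + (c 1 - c (p + 1)) := by
  induction p with
  | zero => simp
  | succ p ih =>
    obtain ⟨h0, ih⟩ := ih (by omega) (by omega)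
    rw [Finset.sum_Icc_succ_top (by omega)]
    have hd := hdec (p + 1) (by omega) hp2
    obtain ⟨u, hu⟩ := Int.eq_ofNat_of_zero_le (sub_nonneg.2 hd)
    have hx := hX (n - (p + 1)) (by omega)
    have h2 := h.mul hX _ (add_nonneg hV h0) (n - (p + 1)) (by omega) (by omega) u
    rw [hu, ← add_assoc]
    refine ⟨by positivity, ?_⟩
    linarith

theorem isSR_local {k : ℕ} {c : ℕ → ℤ} (hpos : ∀ i, 1 ≤ i → i ≤ k → 0 < c i)
    (hanti : ∀ i j, 1 ≤ i → i ≤ j → j ≤ k → c j ≤ c i) (hk : 1 ≤ k)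
    {w : ℕ → ℕ} (h : IsSR k c w) : ∀ j, 1 ≤ j → ∃ s, 1 ≤ s ∧ s ≤ k ∧
      (∀ i, 1 ≤ i → i < s → (w (j + i - 1) : ℤ) ≤ c i) ∧ (w (j + s - 1) : ℤ) < c s := by
  induction h with
  | zero a h =>
    intro j hj
    refine ⟨1, le_rfl, hk, by intros; omega, ?_⟩
    rw [h _ (by omega)]
    exact hpos 1 le_rfl hk
  | cprefix a m h1 h2 h3 h4 =>
    intro j hj
    rcases Nat.lt_or_ge m j with hm | hm
    · refine ⟨1, le_rfl, hk, by intros; omega, ?_⟩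
      rw [h4 _ (by omega)]
      exact hpos 1 le_rfl hk
    · refine ⟨m + 2 - j, by omega, by omega, ?_, ?_⟩
      · intro i hi1 hi2
        rw [h3 _ (by omega) (by omega)]
        exact hanti _ _ hi1 (by omega) (by omega)
      · rw [h4 _ (by omega)]
        exact hpos _ (by omega) (by omega)
  | chunk a s l hs1 hs2 h1 h2 h3 h4 ih =>
    intro j hj
    rcases Nat.lt_or_ge s j with hm | hm
    · rcases Nat.lt_or_ge (s + l) j with hl | hl
      · obtain ⟨s', e1, e2, e3, e4⟩ := ih (j - (s + l)) (by omega)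
        refine ⟨s', e1, e2, ?_, ?_⟩
        · intro i hi1 hi2
          have := e3 i hi1 hi2
          beta_reduce at this
          rwa [show s + l + (j - (s + l) + i - 1) = j + i - 1 by omega] at this
        · beta_reduce at e4
          rwa [show s + l + (j - (s + l) + s' - 1) = j + s' - 1 by omega] at e4
      · refine ⟨1, le_rfl, hk, by intros; omega, ?_⟩
        rw [show j + 1 - 1 = s + (j - s) by omega, h3 _ (by omega) (by omega)]
        exact hpos 1 le_rfl hk
    · refine ⟨s - j + 1, by omega, by omega, ?_, ?_⟩
      · intro i hi1 hi2
        rw [h1 _ (by omega) (by omega)]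
        exact hanti _ _ hi1 (by omega) (by omega)
      · rw [show j + (s - j + 1) - 1 = s by omega]
        exact h2.trans_le (hanti _ _ (by omega) (by omega) (by omega))

theorem prefix_bound {X c : ℕ → ℤ} (hX : ∀ n, 1 ≤ n → 0 < X n) (a : ℕ → ℕ) (t p : ℕ)
    (hp : p ≤ t) (h : ∀ i, 1 ≤ i → i ≤ p → (a (t + 1 - i) : ℤ) ≤ c i) :
    ∑ n ∈ Finset.Icc 1 t, (a n : ℤ) * X n ≤ (∑ i ∈ Finset.Icc 1 p, c i * X (t + 1 - i))
      + ∑ n ∈ Finset.Icc 1 (t - p), (a n : ℤ) * X n := by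
  induction p with
  | zero => simp
  | succ p ih =>
    have ih := ih (by omega) (fun i h1 h2 => h i h1 (by omega))
    rw [Finset.sum_Icc_succ_top (by omega)]
    rw [show t - p = t - (p + 1) + 1 by omega, Finset.sum_Icc_succ_top (by omega)] at ih
    have h1 := h (p + 1) (by omega) le_rfl
    rw [show t + 1 - (p + 1) = t - (p + 1) + 1 by omega] at h1 ⊢
    have h2 := mul_le_mul_of_nonneg_right h1 (hX (t - (p + 1) + 1) (by omega)).le
    linarith

/-- Summand minimality: for a weakly decreasing recurrence vector c with c_k = 1, the
legal (Zeckendorf-type) decomposition of a positive integer N over the scalar PLRS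
uses the fewest summands among all nonnegative integer representations of N.
A representation `a` (with digits a_m, …, a_1 read from the most significant term)
is legal when its reversed digit string is a c-satisfying string. -/
theorem legal_decomposition_summand_minimal
    (k : ℕ) (hk : 2 ≤ k) (c : ℕ → ℤ)
    (hc1 : 0 < c 1)
    (hdec : ∀ i, 1 ≤ i → i < k → c (i + 1) ≤ c i) (hck : c k = 1)
    (Xs : ℕ → ℤ) (hXs1 : Xs 1 = 1)
    (hXsinit : ∀ n, 2 ≤ n → n ≤ k →
      Xs n = (∑ i ∈ Finset.Icc 1 (n - 1), c i * Xs (n - i)) + 1)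
    (hXsrec : ∀ n, k < n → Xs n = ∑ i ∈ Finset.Icc 1 k, c i * Xs (n - i))
    (N : ℤ) (hN : 0 < N)
    (a : ℕ → ℕ) (m : ℕ) (ha0 : ∀ n, m < n → a n = 0)
    (haleg : IsSR k c (fun j => if j ≤ m then a (m + 1 - j) else 0))
    (haN : N = ∑ n ∈ Finset.Icc 1 m, (a n : ℤ) * Xs n)
    (b : ℕ → ℕ) (M : ℕ)
    (hbN : N = ∑ n ∈ Finset.Icc 1 M, (b n : ℤ) * Xs n) :
    (∑ n ∈ Finset.Icc 1 m, a n) ≤ ∑ n ∈ Finset.Icc 1 M, b n := by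
  have hanti : ∀ i j, 1 ≤ i → i ≤ j → j ≤ k → c j ≤ c i := by
    intro i j h1 h2 h3
    induction j, h2 using Nat.le_induction with
    | base => exact le_rfl
    | succ j hij ih => exact (hdec j (by omega) (by omega)).trans (ih (by omega))
  have hpos : ∀ i, 1 ≤ i → i ≤ k → 0 < c i := by
    intro i h1 h2
    have := hanti i k h1 h2 le_rfl
    omega
  have hX : ∀ n, 1 ≤ n → 0 < Xs n := by
    intro n
    induction n using Nat.strong_induction_on with
    | _ n ih =>
      intro hn
      rcases Nat.lt_or_ge k n with h | h
      · rw [hXsrec n h]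
        apply Finset.sum_pos
        · intro i hi
          rw [Finset.mem_Icc] at hi
          exact mul_pos (hpos i hi.1 hi.2) (ih _ (by omega) (by omega))
        · exact ⟨1, by simp; omega⟩
      · rcases Nat.lt_or_ge n 2 with h2 | h2
        · obtain rfl : n = 1 := by omega
          omega
        · rw [hXsinit n h2 h]
          have : 0 ≤ ∑ i ∈ Finset.Icc 1 (n - 1), c i * Xs (n - i) := by
            apply Finset.sum_nonneg
            intro i hi
            rw [Finset.mem_Icc] at hi
            exact (mul_pos (hpos i hi.1 (by omega)) (ih _ (by omega) (by omega))).le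
          omega
  have hinit : ∀ n, 1 ≤ n → n ≤ k →
      Xs n = (∑ i ∈ Finset.Icc 1 (n - 1), c i * Xs (n - i)) + 1 := by
    intro n h1 h2
    rcases Nat.lt_or_ge n 2 with h | h
    · obtain rfl : n = 1 := by omega
      simpa using hXs1
    · exact hXsinit n h h2
  -- telescoping of a shifted convolution
  have hshift : ∀ n p, ∑ i ∈ Finset.Icc 1 (p + 1), c i * Xs (n + 1 - i)
      = c 1 * Xs n + ∑ i ∈ Finset.Icc 1 p, c (i + 1) * Xs (n - i) := by
    intro n p
    induction p with
    | zero => simp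
    | succ p ih =>
      rw [Finset.sum_Icc_succ_top (by omega), ih, Finset.sum_Icc_succ_top (by omega),
        show n + 1 - (p + 1 + 1) = n - (p + 1) by omega]
      ring
  have hsub : ∀ n p, ∑ i ∈ Finset.Icc 1 p, (c i - c (i + 1)) * Xs (n - i)
      = (∑ i ∈ Finset.Icc 1 p, c i * Xs (n - i))
        - ∑ i ∈ Finset.Icc 1 p, c (i + 1) * Xs (n - i) := by
    intro n p
    rw [← Finset.sum_sub_distrib]
    exact Finset.sum_congr rfl (fun i _ => by ring)
  have hord : ∀ n, 1 ≤ n → Orderly Xs n := by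
    intro n hn
    induction n, hn using Nat.le_induction with
    | base => exact Orderly.one hX
    | succ n hn ih =>
      rcases Nat.lt_or_ge n k with h | h
      · refine ih.step hX hn (c 1)
          (∑ i ∈ Finset.Icc 1 (n - 1), (c i - c (i + 1)) * Xs (n - i)) ?_ ?_
        · have e1 := hinit n hn h.le
          have e2 := hinit (n + 1) (by omega) h
          have e3 := hshift n (n - 1)
          rw [show n - 1 + 1 = n by omega] at e3
          rw [show n + 1 - 1 = n by omega, e3] at e2
          rw [hsub]
          linarith
        · intro V hV
          have := (ih.diff hX k c hdec (n - 1) (by omega) (by omega) V hV).2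
          have := hpos (n - 1 + 1) (by omega) (by omega)
          linarith
      · have e2 := hXsrec (n + 1) (by omega)
        have e3 := hshift n (k - 1)
        rw [show k - 1 + 1 = k by omega] at e3
        rw [e3] at e2
        obtain ⟨j, hj1, hj2, e1⟩ : ∃ j, 1 ≤ j ∧ j ≤ n ∧
            Xs n = (∑ i ∈ Finset.Icc 1 (k - 1), c i * Xs (n - i)) + Xs j := by
          rcases Nat.lt_or_ge k n with h' | h'
          · refine ⟨n - k, by omega, by omega, ?_⟩
            have e4 := hXsrec n h'
            have e5 : ∑ i ∈ Finset.Icc 1 (k - 1 + 1), c i * Xs (n - i)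
              = (∑ i ∈ Finset.Icc 1 (k - 1), c i * Xs (n - i))
                + c (k - 1 + 1) * Xs (n - (k - 1 + 1)) :=
              Finset.sum_Icc_succ_top (by omega) _
            rw [show k - 1 + 1 = k by omega, hck, one_mul] at e5
            rw [e4, e5]
          · obtain rfl : n = k := by omega
            refine ⟨1, le_rfl, hn, ?_⟩
            rw [hXs1]
            exact hinit n hn le_rfl
        refine ih.step hX hn (c 1)
          ((∑ i ∈ Finset.Icc 1 (k - 1), (c i - c (i + 1)) * Xs (n - i)) + Xs j) ?_ ?_
        · rw [hsub]
          linarith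
        · intro V hV
          obtain ⟨d1, d2⟩ := ih.diff hX k c hdec (k - 1) (by omega) (by omega) V hV
          have d3 := ih _ (add_nonneg hV d1) j hj1 hj2
          rw [show k - 1 + 1 = k by omega, hck] at d2
          rw [← add_assoc]
          linarith
  -- upper bounds for partial convolutions
  have hmono : ∀ t p q, p ≤ q → q ≤ t → q ≤ k →
      ∑ i ∈ Finset.Icc 1 p, c i * Xs (t + 1 - i)
        ≤ ∑ i ∈ Finset.Icc 1 q, c i * Xs (t + 1 - i) := by
    intro t p q h1 h2 h3
    apply Finset.sum_le_sum_of_subset_of_nonneg (Finset.Icc_subset_Icc_right h1)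
    intro i hi _
    rw [Finset.mem_Icc] at hi
    exact (mul_pos (hpos i hi.1 (by omega)) (hX _ (by omega))).le
  have hup : ∀ t p, p ≤ t → p ≤ k →
      ∑ i ∈ Finset.Icc 1 p, c i * Xs (t + 1 - i) ≤ Xs (t + 1) := by
    intro t p h1 h2
    rcases Nat.lt_or_ge t k with h | h
    · have e1 := hinit (t + 1) (by omega) h
      have e2 := hmono t p t h1 le_rfl h.le
      rw [show t + 1 - 1 = t by omega] at e1
      linarith
    · have e1 := hXsrec (t + 1) (by omega)
      have e2 := hmono t p k h2 h le_rfl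
      linarith
  -- the local form of legality
  have hloc : ∀ t, 1 ≤ t → ∃ s, 1 ≤ s ∧ s ≤ k ∧ s ≤ t + 1 ∧
      (∀ i, 1 ≤ i → i < s → (a (t + 1 - i) : ℤ) ≤ c i) ∧
      (s ≤ t → (a (t + 1 - s) : ℤ) < c s) := by
    intro t ht
    rcases Nat.lt_or_ge m t with h | h
    · refine ⟨1, le_rfl, by omega, by omega, by intros; omega, ?_⟩
      intro _
      rw [ha0 _ (by omega)]
      exact hc1
    · obtain ⟨s, e1, e2, e3, e4⟩ := isSR_local hpos hanti (by omega) haleg (m + 1 - t) (by omega)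
      have e3' : ∀ i, 1 ≤ i → i < s → i ≤ t → (a (t + 1 - i) : ℤ) ≤ c i := by
        intro i h1 h2 h3
        have := e3 i h1 h2
        rwa [if_pos (by omega), show m + 1 - (m + 1 - t + i - 1) = t + 1 - i by omega] at this
      rcases Nat.lt_or_ge t s with hs | hs
      · exact ⟨t + 1, by omega, by omega, le_rfl,
          fun i h1 h2 => e3' i h1 (by omega) (by omega), fun h => by omega⟩
      · refine ⟨s, e1, e2, by omega, fun i h1 h2 => e3' i h1 h2 (by omega), fun _ => ?_⟩
        rwa [if_pos (by omega), show m + 1 - (m + 1 - t + s - 1) = t + 1 - s by omega] at e4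
  have hlt : ∀ t, ∑ n ∈ Finset.Icc 1 t, (a n : ℤ) * Xs n < Xs (t + 1) := by
    intro t
    induction t using Nat.strong_induction_on with
    | _ t ih =>
      rcases Nat.eq_zero_or_pos t with h | h
      · subst h
        simp [hXs1]
      · obtain ⟨s, e1, e2, e3, e4, e5⟩ := hloc t h
        rcases Nat.lt_or_ge t s with hs | hs
        · obtain rfl : s = t + 1 := by omega
          have b1 := prefix_bound (c := c) hX a t t le_rfl
            (fun i h1 h2 => e4 i h1 (by omega))
          have b2 := hinit (t + 1) (by omega) e2
          rw [show t + 1 - 1 = t by omega] at b2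
          simp only [Nat.sub_self, zero_lt_one, Finset.Icc_eq_empty_of_lt,
            Finset.sum_empty] at b1
          linarith
        · obtain ⟨s, rfl⟩ : ∃ p, s = p + 1 := ⟨s - 1, by omega⟩
          have b1 := prefix_bound (c := c) hX a t s (by omega)
            (fun i h1 h2 => e4 i h1 (by omega))
          have b2 := hup t (s + 1) hs e2
          rw [Finset.sum_Icc_succ_top (by omega)] at b2
          have b3 := e5 hs
          have b4 := ih (t - (s + 1)) (by omega)
          rw [show t - s = t - (s + 1) + 1 by omega, Finset.sum_Icc_succ_top (by omega)] at b1
          rw [show t + 1 - (s + 1) = t - (s + 1) + 1 by omega] at b2 b3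
          have b5 := mul_le_mul_of_nonneg_right (Int.add_one_le_of_lt b3)
            (hX (t - (s + 1) + 1) (by omega)).le
          linarith
  have hnn : ∀ (f : ℕ → ℕ) t, 0 ≤ ∑ n ∈ Finset.Icc 1 t, (f n : ℤ) * Xs n := by
    intro f t
    apply Finset.sum_nonneg
    intro i hi
    rw [Finset.mem_Icc] at hi
    have := hX i hi.1
    positivity
  have hcost : ∀ t, greedyCost Xs t (∑ n ∈ Finset.Icc 1 t, (a n : ℤ) * Xs n)
      = ∑ n ∈ Finset.Icc 1 t, (a n : ℤ) := by
    intro t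
    induction t with
    | zero => simp [greedyCost]
    | succ t ih =>
      rw [Finset.sum_Icc_succ_top (by omega), Finset.sum_Icc_succ_top (by omega),
        greedyCost_add_mul Xs hX _ (by omega), greedyCost_of_lt Xs t _ (hnn a t) (hlt t), ih]
  have hb : ∀ L, 1 ≤ L → ∀ p, p ≤ L →
      greedyCost Xs L (∑ n ∈ Finset.Icc 1 p, (b n : ℤ) * Xs n)
        ≤ ∑ n ∈ Finset.Icc 1 p, (b n : ℤ) := by
    intro L hL p hp
    induction p with
    | zero =>
      have : ∀ L, greedyCost Xs L 0 = 0 := by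
        intro L
        induction L with
        | zero => rfl
        | succ L ih => simp [greedyCost, ih]
      simp [this]
    | succ p ih =>
      have ih := ih (by omega)
      rw [Finset.sum_Icc_succ_top (by omega), Finset.sum_Icc_succ_top (by omega)]
      have := (hord L hL).mul hX _ (hnn b p) (p + 1) (by omega) hp (b (p + 1))
      linarith
  have hext : ∀ g : ℕ → ℤ, ∑ n ∈ Finset.Icc 1 (m + M + 1), (a n : ℤ) * g n
      = ∑ n ∈ Finset.Icc 1 m, (a n : ℤ) * g n := by
    intro g
    symm
    apply Finset.sum_subset (Finset.Icc_subset_Icc_right (by omega))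
    intro i hi hi2
    rw [Finset.mem_Icc] at hi hi2
    rw [ha0 i (by omega)]
    simp
  have f1 := hcost (m + M + 1)
  have f2 := hb (m + M + 1) (by omega) M (by omega)
  have f3 := hext (fun _ => 1)
  simp only [mul_one] at f3
  rw [hext, f3, ← haN] at f1
  rw [← hbN, f1] at f2
  exact_mod_cast f2
end
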